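/- Let J be a finite nonempty set, let {X_i}_{i ∈ J} be {0,1}-valued random variables with λ = Σ_{i ∈ J} E(X_i) > 0, let W = Σ_{i ∈ J} X_i, and let I be uniformly distributed on J and independent of the family {X_i}. Let W* be an ℕ-valued random variable defined on the same probability space such that ℙ(W* = w) = ℙ(W = w | X_I = 1) for all w ∈ ℕ. Then ‖L(W) - Poi_λ‖_TV ≤ (1 - e^{-λ}) · E|W + 1 - W*|. -/

import Mathlib

open MeasureTheory

/-- The Poisson distribution on `ℕ` with mean `lam`, assigning mass
`e^{-λ} λ^k / k!` to each `k : ℕ`. -/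
noncomputable def poissonMeasure (lam : ℝ) : Measure ℕ :=
  Measure.sum fun k : ℕ =>
    (ENNReal.ofReal (Real.exp (-lam) * lam ^ k / (Nat.factorial k))) • Measure.dirac k

open ProbabilityTheory

noncomputable def pw (l : ℝ) (k : ℕ) : ℝ := Real.exp (-l) * l ^ k / (Nat.factorial k)

lemma pw_pos {l : ℝ} (hl : 0 < l) (k : ℕ) : 0 < pw l k := by unfold pw; positivity

lemma pw_succ (l : ℝ) (k : ℕ) : ((k+1 : ℕ) : ℝ) * pw l (k+1) = l * pw l k := by
  unfold pw
  rw [Nat.factorial_succ]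
  have : (Nat.factorial k : ℝ) ≠ 0 := by positivity
  push_cast
  field_simp
  ring

lemma pw_hasSum (l : ℝ) : HasSum (pw l) 1 := by
  have h := (NormedSpace.expSeries_div_hasSum_exp (𝔸 := ℝ) l).mul_left (Real.exp (-l))
  rw [← Real.exp_eq_exp_ℝ, ← Real.exp_add] at h
  simp only [neg_add_cancel, Real.exp_zero] at h
  have e : pw l = fun k => Real.exp (-l) * (l ^ k / (Nat.factorial k)) := by
    funext k; unfold pw; ring
  rw [e]; exact h

noncomputable def pF (l : ℝ) (k : ℕ) : ℝ := ∑ i ∈ Finset.range k, pw l i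

lemma pF_bound {l : ℝ} (hl : 0 < l) (k : ℕ) : l * pF l k ≤ k * (pF l (k+1) - Real.exp (-l)) := by
  have h0 : pw l 0 = Real.exp (-l) := by simp [pw]
  unfold pF
  rw [Finset.sum_range_succ', h0, add_sub_cancel_right, Finset.mul_sum, Finset.mul_sum]
  apply Finset.sum_le_sum
  intro i hi
  rw [← pw_succ]
  have := Finset.mem_range.1 hi
  have h2 : ((i+1:ℕ):ℝ) ≤ k := by exact_mod_cast this
  exact mul_le_mul_of_nonneg_right h2 (pw_pos hl _).le

lemma pG_bound {l : ℝ} (hl : 0 < l) (k : ℕ) : k * (1 - pF l (k+1)) ≤ l * (1 - pF l k) := by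
  have h1 := (hasSum_nat_add_iff' (f := pw l) (k+1)).2 (pw_hasSum l)
  have h2 := (hasSum_nat_add_iff' (f := pw l) k).2 (pw_hasSum l)
  refine hasSum_le ?_ (h1.mul_left (k:ℝ)) (h2.mul_left l)
  intro i
  rw [← pw_succ]
  have h2 : (k:ℝ) ≤ ((i+k+1:ℕ):ℝ) := by exact_mod_cast (by omega)
  exact mul_le_mul_of_nonneg_right h2 (pw_pos hl _).le

open Classical in
noncomputable def pA (l : ℝ) (A : Set ℕ) (i : ℕ) : ℝ := if i ∈ A then pw l i else 0

noncomputable def pT (l : ℝ) (A : Set ℕ) : ℝ := ∑' i, pA l A i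

lemma pA_nonneg {l : ℝ} (hl : 0 < l) (A : Set ℕ) (i : ℕ) : 0 ≤ pA l A i := by
  unfold pA; split_ifs <;> simp [(pw_pos hl i).le]

lemma pA_le {l : ℝ} (hl : 0 < l) (A : Set ℕ) (i : ℕ) : pA l A i ≤ pw l i := by
  unfold pA; split_ifs <;> simp [(pw_pos hl i).le]

lemma pA_hasSum {l : ℝ} (hl : 0 < l) (A : Set ℕ) : HasSum (pA l A) (pT l A) :=
  (Summable.of_nonneg_of_le (pA_nonneg hl A) (pA_le hl A) (pw_hasSum l).summable).hasSum

lemma pA_compl (l : ℝ) (A : Set ℕ) (i : ℕ) : pA l Aᶜ i = pw l i - pA l A i := by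
  unfold pA; by_cases h : i ∈ A <;> simp [h]

lemma pT_compl {l : ℝ} (hl : 0 < l) (A : Set ℕ) : pT l Aᶜ = 1 - pT l A := by
  have := (pw_hasSum l).sub (pA_hasSum hl A)
  refine (pA_hasSum hl Aᶜ).unique ?_
  rw [show pA l Aᶜ = fun i => pw l i - pA l A i from funext (pA_compl l A)]
  exact this

noncomputable def sf (l : ℝ) (A : Set ℕ) (k : ℕ) : ℝ :=
  (∑ i ∈ Finset.range k, pA l A i - pT l A * pF l k) / (k * pw l k)

lemma sf_compl {l : ℝ} (hl : 0 < l) (A : Set ℕ) (k : ℕ) : sf l Aᶜ k = - sf l A k := by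
  unfold sf
  simp only [pA_compl, pT_compl hl, Finset.sum_sub_distrib]
  rw [← neg_div]; congr 1; unfold pF; ring

open Classical in
lemma sf_eq {l : ℝ} (hl : 0 < l) (A : Set ℕ) (k : ℕ) :
    l * sf l A (k+1) - k * sf l A k = (if k ∈ A then 1 else 0) - pT l A := by
  have hp := pw_pos hl k
  have h1 : l * sf l A (k+1) = (∑ i ∈ Finset.range (k+1), pA l A i - pT l A * pF l (k+1)) / pw l k := by
    unfold sf; rw [pw_succ]; field_simp
  have h2 : k * sf l A k = (∑ i ∈ Finset.range k, pA l A i - pT l A * pF l k) / pw l k := by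
    unfold sf
    rcases Nat.eq_zero_or_pos k with rfl | h
    · simp [pF]
    · have : (k:ℝ) ≠ 0 := by positivity
      field_simp
  rw [h1, h2, ← sub_div, Finset.sum_range_succ, pF, pF, Finset.sum_range_succ, pA]
  split_ifs <;> field_simp <;> ring

lemma sf_diff_le {l : ℝ} (hl : 0 < l) (A : Set ℕ) (k : ℕ) (hk : 1 ≤ k) :
    sf l A (k+1) - sf l A k ≤ (1 - Real.exp (-l)) / l := by
  have hp := pw_pos hl k
  have hk' : (1:ℝ) ≤ k := by exact_mod_cast hk
  have hk0 : (0:ℝ) < k := by linarith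
  set a := ∑ i ∈ Finset.range k, pA l A i with ha
  have ha0 : 0 ≤ a := Finset.sum_nonneg fun i _ => pA_nonneg hl A i
  have hS : ∑ i ∈ Finset.range (k+1), pA l A i = a + pA l A k := Finset.sum_range_succ _ _
  have hT : a + pA l A k ≤ pT l A := by
    rw [← hS]; exact sum_le_hasSum _ (fun i _ => pA_nonneg hl A i) (pA_hasSum hl A)
  obtain ⟨T, hTe⟩ : ∃ T, T = pT l A - a - pA l A k := ⟨_, rfl⟩
  have hT0 : 0 ≤ T := by linarith
  have hPA : pT l A = a + pA l A k + T := by linarith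
  have hb := pF_bound hl k
  have hg := pG_bound hl k
  have he := Real.exp_pos (-l)
  have he1 : Real.exp (-l) ≤ 1 := Real.exp_le_one_iff.2 (by linarith)
  have hα0 := pA_nonneg hl A k
  have hα := pA_le hl A k
  have key : k * (a + pA l A k - pT l A * pF l (k+1)) - l * (a - pT l A * pF l k)
      ≤ k * (1 - Real.exp (-l)) * pw l k := by
    rw [hPA]
    have e1 : a * (k * (1 - pF l (k+1)) - l * (1 - pF l k)) ≤ 0 :=
      mul_nonpos_of_nonneg_of_nonpos ha0 (by linarith)
    have e2 : T * (l * pF l k - k * pF l (k+1)) ≤ 0 :=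
      mul_nonpos_of_nonneg_of_nonpos hT0 (by nlinarith)
    have e3 : pA l A k * (k * (1 - pF l (k+1)) + l * pF l k) ≤ pA l A k * (k * (1 - Real.exp (-l))) :=
      mul_le_mul_of_nonneg_left (by linarith) hα0
    have e4 : pA l A k * (k * (1 - Real.exp (-l))) ≤ pw l k * (k * (1 - Real.exp (-l))) :=
      mul_le_mul_of_nonneg_right hα (mul_nonneg hk0.le (by linarith))
    nlinarith
  have h1 : sf l A (k+1) = (a + pA l A k - pT l A * pF l (k+1)) / (l * pw l k) := by
    unfold sf; rw [pw_succ, hS]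
  have h2 : sf l A k = (a - pT l A * pF l k) / (k * pw l k) := rfl
  have : sf l A (k+1) - sf l A k = (k * (a + pA l A k - pT l A * pF l (k+1)) - l * (a - pT l A * pF l k)) / (k * l * pw l k) := by
    rw [h1, h2]; field_simp
  rw [this, div_le_div_iff₀ (by positivity) hl]
  nlinarith

lemma sf_diff_abs {l : ℝ} (hl : 0 < l) (A : Set ℕ) (k : ℕ) (hk : 1 ≤ k) :
    |sf l A (k+1) - sf l A k| ≤ (1 - Real.exp (-l)) / l := by
  rw [abs_le]
  have h1 := sf_diff_le hl A k hk
  have h2 := sf_diff_le hl Aᶜ k hk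
  rw [sf_compl hl, sf_compl hl] at h2
  constructor <;> linarith

lemma lip_aux (f : ℕ → ℝ) (C : ℝ) (h : ∀ k, 1 ≤ k → |f (k+1) - f k| ≤ C) (m : ℕ) (hm : 1 ≤ m) (d : ℕ) :
    |f (m + d) - f m| ≤ C * d := by
  induction d with
  | zero => simp
  | succ d ih =>
    have := h (m+d) (by omega)
    have h3 := abs_sub_le (f (m+d+1)) (f (m+d)) (f m)
    push_cast
    rw [← add_assoc]
    linarith

lemma lip_aux2 (f : ℕ → ℝ) (C : ℝ) (h : ∀ k, 1 ≤ k → |f (k+1) - f k| ≤ C) (m n : ℕ) (hm : 1 ≤ m) (hn : 1 ≤ n) :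
    |f m - f n| ≤ C * |(m:ℝ) - n| := by
  rcases le_total m n with h' | h'
  · obtain ⟨d, rfl⟩ := Nat.exists_eq_add_of_le h'
    have := lip_aux f C h m hm d
    rw [abs_sub_comm]
    push_cast
    simpa using this
  · obtain ⟨d, rfl⟩ := Nat.exists_eq_add_of_le h'
    have := lip_aux f C h n hn d
    push_cast
    simpa using this

open Classical in
lemma poisson_toReal {l : ℝ} (hl : 0 < l) (A : Set ℕ) :
    (_root_.poissonMeasure l A).toReal = pT l A := by
  have h : _root_.poissonMeasure l A = ∑' k, ENNReal.ofReal (pA l A k) := by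
    unfold _root_.poissonMeasure
    rw [Measure.sum_apply _ (MeasurableSet.of_discrete)]
    congr 1; funext k
    rw [Measure.smul_apply, Measure.dirac_apply, smul_eq_mul]
    unfold pA pw
    by_cases hk : k ∈ A <;> simp [hk]
  rw [h, ← ENNReal.ofReal_tsum_of_nonneg (pA_nonneg hl A) (pA_hasSum hl A).summable,
    ENNReal.toReal_ofReal (tsum_nonneg (pA_nonneg hl A))]
  rfl

lemma ae_sum_repr {Ω : Type*} [MeasurableSpace Ω] (P : Measure Ω)
    (V : Ω → ℕ) (n : ℕ) (hVn : ∀ᵐ ω ∂P, V ω ≤ n) (g : ℕ → ℝ) :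
    (fun ω => g (V ω)) =ᵐ[P] fun ω => ∑ w ∈ Finset.range (n+1),
      ({ω | V ω = w} : Set Ω).indicator (fun _ => g w) ω := by
  filter_upwards [hVn] with ω h
  rw [Finset.sum_eq_single (V ω)]
  · simp
  · intro b _ hb
    simp [hb.symm]
  · intro h'; simp at h'; omega

lemma int_of_bdd {Ω : Type*} [MeasurableSpace Ω] (P : Measure Ω) [IsProbabilityMeasure P]
    (V : Ω → ℕ) (hV : Measurable V) (n : ℕ) (hVn : ∀ᵐ ω ∂P, V ω ≤ n) (g : ℕ → ℝ) :
    Integrable (fun ω => g (V ω)) P := by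
  refine (integrable_congr (ae_sum_repr P V n hVn g)).2 ?_
  refine integrable_finset_sum _ fun w _ => ?_
  exact (integrable_const _).indicator (hV (measurableSet_singleton w))

lemma integral_of_bdd {Ω : Type*} [MeasurableSpace Ω] (P : Measure Ω) [IsProbabilityMeasure P]
    (V : Ω → ℕ) (hV : Measurable V) (n : ℕ) (hVn : ∀ᵐ ω ∂P, V ω ≤ n) (g : ℕ → ℝ) :
    ∫ ω, g (V ω) ∂P = ∑ w ∈ Finset.range (n+1), P.real {ω | V ω = w} * g w := by
  have hm : ∀ w, MeasurableSet {ω | V ω = w} := fun w => hV (measurableSet_singleton w)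
  rw [integral_congr_ae (ae_sum_repr P V n hVn g), integral_finset_sum]
  · refine Finset.sum_congr rfl fun w _ => ?_
    rw [integral_indicator_const _ (hm w), smul_eq_mul]
  · intro w _
    exact (integrable_const _).indicator (hm w)

lemma mix_aux
    {Ω : Type*} [MeasurableSpace Ω] (P : Measure Ω) [IsProbabilityMeasure P]
    {J : Type*} [Fintype J] [Nonempty J] [MeasurableSpace J] [MeasurableSingletonClass J]
    (X : J → Ω → ℕ) (hXm : ∀ i, Measurable (X i))
    (hval : ∀ i ω, X i ω = 0 ∨ X i ω = 1)
    (W : Ω → ℕ) (hW : ∀ ω, W ω = ∑ i, X i ω)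
    (I : Ω → J) (hIm : Measurable I)
    (hIunif : ∀ j, P {ω | I ω = j} = (Fintype.card J : ENNReal)⁻¹)
    (hindep : IndepFun I (fun ω => fun i => X i ω) P)
    (B : Set ℕ) :
    P.real ({ω | X (I ω) ω = 1} ∩ {ω | W ω ∈ B}) =
      (Fintype.card J : ℝ)⁻¹ * ∑ i, ∫ ω, ({ω | W ω ∈ B} : Set Ω).indicator (fun ω => (X i ω : ℝ)) ω ∂P := by
  have hWm : Measurable W := by
    rw [show W = fun ω => ∑ i, X i ω from funext hW]
    exact Finset.measurable_fun_sum _ fun i _ => hXm i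
  have hBm : MeasurableSet {ω | W ω ∈ B} := hWm (MeasurableSet.of_discrete (s := B))
  have hm : ∀ j, MeasurableSet ({ω | X j ω = 1} ∩ {ω | W ω ∈ B}) := fun j =>
    (hXm j (measurableSet_singleton 1)).inter hBm
  have hIj : ∀ j, MeasurableSet {ω | I ω = j} := fun j => hIm (measurableSet_singleton j)
  have hset : ({ω | X (I ω) ω = 1} ∩ {ω | W ω ∈ B}) =
      ⋃ j ∈ (Finset.univ : Finset J), ({ω | I ω = j} ∩ ({ω | X j ω = 1} ∩ {ω | W ω ∈ B})) := by
    ext ω; simp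
  rw [hset, measureReal_biUnion_finset]
  · rw [Finset.mul_sum]
    refine Finset.sum_congr rfl fun j _ => ?_
    have hS : MeasurableSet {x : J → ℕ | x j = 1 ∧ ∑ i, x i ∈ B} := by
      refine MeasurableSet.inter (s₁ := {x : J → ℕ | x j = 1}) (s₂ := {x : J → ℕ | ∑ i, x i ∈ B}) ?_ ?_
      · exact (measurable_pi_apply j) (measurableSet_singleton 1)
      · have : Measurable fun x : J → ℕ => ∑ i, x i :=
          Finset.measurable_fun_sum _ fun i _ => measurable_pi_apply i
        exact this (MeasurableSet.of_discrete (s := B))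
    have h := hindep.measure_inter_preimage_eq_mul {j} _ (measurableSet_singleton j) hS
    have e : (fun ω => fun i => X i ω) ⁻¹' {x : J → ℕ | x j = 1 ∧ ∑ i, x i ∈ B}
        = {ω | X j ω = 1} ∩ {ω | W ω ∈ B} := by
      ext ω; simp [hW]
    rw [e] at h
    have e2 : I ⁻¹' {j} = {ω | I ω = j} := rfl
    rw [e2, hIunif] at h
    rw [measureReal_def, h, ENNReal.toReal_mul, ENNReal.toReal_inv, ENNReal.toReal_natCast]
    congr 1
    have : ({ω | W ω ∈ B} : Set Ω).indicator (fun ω => (X j ω : ℝ)) =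
        ({ω | X j ω = 1} ∩ {ω | W ω ∈ B} : Set Ω).indicator (fun _ => (1:ℝ)) := by
      funext ω
      by_cases h1 : W ω ∈ B <;> rcases hval j ω with h2 | h2 <;> simp [h1, h2]
    rw [this, integral_indicator_const _ (hm j)]
    simp [measureReal_def]
  · intro i _ j _ hij
    refine Set.disjoint_left.2 fun ω h1 h2 => hij ?_
    exact h1.1.symm.trans h2.1
  · exact fun j _ => (hIj j).inter (hm j)

lemma size_bias_law
    {Ω : Type*} [MeasurableSpace Ω] (P : Measure Ω) [IsProbabilityMeasure P]
    {J : Type*} [Fintype J] [Nonempty J] [MeasurableSpace J] [MeasurableSingletonClass J]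
    (X : J → Ω → ℕ) (hXm : ∀ i, Measurable (X i))
    (hval : ∀ i ω, X i ω = 0 ∨ X i ω = 1)
    (lam : ℝ) (hlam : lam = ∑ i, ∫ ω, (X i ω : ℝ) ∂P) (hlampos : 0 < lam)
    (W : Ω → ℕ) (hW : ∀ ω, W ω = ∑ i, X i ω)
    (I : Ω → J) (hIm : Measurable I)
    (hIunif : ∀ j, P {ω | I ω = j} = (Fintype.card J : ENNReal)⁻¹)
    (hindep : IndepFun I (fun ω => fun i => X i ω) P)
    (Wstar : Ω → ℕ)
    (hWstar : ∀ w : ℕ, P {ω | Wstar ω = w} = (P[|{ω | X (I ω) ω = 1}]) {ω | W ω = w}) (w : ℕ) :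
    lam * P.real {ω | Wstar ω = w} = w * P.real {ω | W ω = w} := by
  have hWm : Measurable W := by
    rw [show W = fun ω => ∑ i, X i ω from funext hW]
    exact Finset.measurable_fun_sum _ fun i _ => hXm i
  have hwm : MeasurableSet {ω | W ω = w} := hWm (measurableSet_singleton w)
  have h1 := mix_aux P X hXm hval W hW I hIm hIunif hindep Set.univ
  have h2 := mix_aux P X hXm hval W hW I hIm hIunif hindep {w}
  simp only [Set.mem_univ, Set.setOf_true, Set.inter_univ, Set.indicator_univ, ← hlam] at h1
  simp only [Set.mem_singleton_iff] at h2
  have hb : ∀ i, Integrable (fun ω => (X i ω : ℝ)) P := fun i =>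
    int_of_bdd P (X i) (hXm i) 1 (.of_forall fun ω => by rcases hval i ω with h | h <;> simp [h]) (fun k => (k:ℝ))
  rw [← integral_finset_sum _ (fun i _ => (hb i).indicator hwm)] at h2
  have e : (fun ω => ∑ i, ({ω | W ω = w} : Set Ω).indicator (fun ω => (X i ω : ℝ)) ω)
      = ({ω | W ω = w} : Set Ω).indicator (fun _ => (w:ℝ)) := by
    funext ω
    by_cases h : W ω = w
    · simp only [Set.indicator, Set.mem_setOf_eq, h, if_true]
      rw [← h, hW]; push_cast; rfl
    · simp [h]
  rw [e, integral_indicator_const _ hwm, smul_eq_mul] at h2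
  have h3 := hWstar w
  rw [cond_apply' hwm] at h3
  have h4 : P.real {ω | Wstar ω = w} = (P.real {ω | X (I ω) ω = 1})⁻¹ *
      P.real ({ω | X (I ω) ω = 1} ∩ {ω | W ω = w}) := by
    rw [measureReal_def, h3, ENNReal.toReal_mul, ENNReal.toReal_inv]; rfl
  rw [h4, h1, h2]
  have : (Fintype.card J : ℝ) ≠ 0 := by positivity
  field_simp

/-- The size-bias coupling bound: with `{X_i}`, `λ`, `W`, `I` as in the size-bias
construction, if `W*` has the conditional law of `W` given `X_I = 1`, then
`‖L(W) - Poi_λ‖_TV ≤ (1 - e^{-λ}) E|W + 1 - W*|`. -/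
theorem size_bias_poisson_approx
    {Ω : Type*} [MeasurableSpace Ω] (P : Measure Ω) [IsProbabilityMeasure P]
    {J : Type*} [Fintype J] [Nonempty J] [MeasurableSpace J] [MeasurableSingletonClass J]
    (X : J → Ω → ℕ) (hXm : ∀ i, Measurable (X i))
    (hval : ∀ i ω, X i ω = 0 ∨ X i ω = 1)
    (lam : ℝ) (hlam : lam = ∑ i, ∫ ω, (X i ω : ℝ) ∂P) (hlampos : 0 < lam)
    (W : Ω → ℕ) (hW : ∀ ω, W ω = ∑ i, X i ω)
    (I : Ω → J) (hIm : Measurable I)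
    (hIunif : ∀ j, P {ω | I ω = j} = (Fintype.card J : ENNReal)⁻¹)
    (hindep : IndepFun I (fun ω => fun i => X i ω) P)
    (Wstar : Ω → ℕ) (hWstarm : Measurable Wstar)
    (hWstar : ∀ w : ℕ, P {ω | Wstar ω = w} = (P[|{ω | X (I ω) ω = 1}]) {ω | W ω = w}) :
    ∀ A : Set ℕ,
      |((P.map W) A).toReal - (poissonMeasure lam A).toReal| ≤
        (1 - Real.exp (-lam)) * ∫ ω, |(W ω : ℝ) + 1 - (Wstar ω : ℝ)| ∂P := by
  intro A
  classical
  have hWm : Measurable W := by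
    rw [show W = fun ω => ∑ i, X i ω from funext hW]
    exact Finset.measurable_fun_sum _ fun i _ => hXm i
  set n := Fintype.card J with hn
  have hWn : ∀ ω, W ω ≤ n := by
    intro ω
    rw [hW]
    calc ∑ i, X i ω ≤ ∑ _i : J, 1 := Finset.sum_le_sum fun i _ => by
          rcases hval i ω with h | h <;> simp [h]
      _ = n := by simp [hn]
  have hlaw := size_bias_law P X hXm hval lam hlam hlampos W hW I hIm hIunif hindep Wstar hWstar
  have hz : ∀ w, (w = 0 ∨ n < w) → P {ω | Wstar ω = w} = 0 := by
    intro w hw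
    have h := hlaw w
    have h0 : (w:ℝ) * P.real {ω | W ω = w} = 0 := by
      rcases hw with rfl | hw
      · simp
      · have : {ω | W ω = w} = ∅ := by
          ext ω; have := hWn ω; simp; omega
        simp [this]
    rw [h0] at h
    have h5 := (mul_eq_zero.1 h).resolve_left hlampos.ne'
    exact (measureReal_eq_zero_iff).1 h5
  have hae : ∀ᵐ ω ∂P, 1 ≤ Wstar ω ∧ Wstar ω ≤ n := by
    have : ∀ w : ℕ, ∀ᵐ ω ∂P, (w = 0 ∨ n < w) → Wstar ω ≠ w := by
      intro w
      by_cases hw : w = 0 ∨ n < w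
      · have := hz w hw
        rw [ae_iff]
        simpa [hw] using this
      · exact .of_forall fun ω h => absurd h hw
    filter_upwards [ae_all_iff.2 this] with ω h
    have := h (Wstar ω)
    by_contra hc
    exact this (by omega) rfl
  have hae2 : ∀ᵐ ω ∂P, Wstar ω ≤ n := hae.mono fun _ h => h.2
  have hWae : ∀ᵐ ω ∂P, W ω ≤ n := .of_forall hWn
  set f := sf lam A with hf
  have hi1 : Integrable (fun ω => f (W ω + 1)) P := int_of_bdd P W hWm n hWae (fun k => f (k+1))
  have hi2 : Integrable (fun ω => (W ω : ℝ) * f (W ω)) P := int_of_bdd P W hWm n hWae (fun k => (k:ℝ) * f k)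
  have hi3 : Integrable (fun ω => f (Wstar ω)) P := int_of_bdd P Wstar hWstarm n hae2 f
  have hi4 : Integrable (fun ω => (W ω : ℝ)) P := int_of_bdd P W hWm n hWae (fun k => (k:ℝ))
  have hi5 : Integrable (fun ω => (Wstar ω : ℝ)) P := int_of_bdd P Wstar hWstarm n hae2 (fun k => (k:ℝ))
  have hsb : lam * ∫ ω, f (Wstar ω) ∂P = ∫ ω, (W ω : ℝ) * f (W ω) ∂P := by
    rw [integral_of_bdd P Wstar hWstarm n hae2 f,
      integral_of_bdd P W hWm n hWae (fun k => (k:ℝ) * f k), Finset.mul_sum]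
    refine Finset.sum_congr rfl fun w _ => ?_
    rw [← mul_assoc, hlaw w]; ring
  have hAm : MeasurableSet {ω | W ω ∈ A} := hWm (MeasurableSet.of_discrete (s := A))
  have hL : ((P.map W) A).toReal - pT lam A = ∫ ω, (lam * f (W ω + 1) - W ω * f (W ω)) ∂P := by
    have e : (fun ω => lam * f (W ω + 1) - W ω * f (W ω)) =
        fun ω => ({ω | W ω ∈ A} : Set Ω).indicator (fun _ => (1:ℝ)) ω - pT lam A := by
      funext ω
      rw [hf, sf_eq hlampos]; rfl
    rw [e, integral_sub ((integrable_const _).indicator hAm) (integrable_const _),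
      integral_indicator_const _ hAm, Measure.map_apply hWm MeasurableSet.of_discrete]
    simp [measureReal_def]
    rfl
  rw [poisson_toReal hlampos, hL, integral_sub (hi1.const_mul _) hi2, ← hsb, integral_const_mul,
    ← mul_sub, ← integral_sub hi1 hi3, abs_mul, abs_of_pos hlampos]
  have hfin : |∫ ω, (f (W ω + 1) - f (Wstar ω)) ∂P| ≤
      ∫ ω, (1 - Real.exp (-lam)) / lam * |(W ω : ℝ) + 1 - (Wstar ω : ℝ)| ∂P := by
    refine (abs_integral_le_integral_abs).trans ?_
    refine integral_mono_ae (hi1.sub hi3).abs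
      ((((hi4.add (integrable_const 1)).sub hi5).abs).const_mul _) ?_
    filter_upwards [hae] with ω h
    have := lip_aux2 f _ (sf_diff_abs hlampos A) (W ω + 1) (Wstar ω) (by omega) h.1
    push_cast at this
    exact this
  rw [integral_const_mul] at hfin
  calc _ ≤ lam * _ := mul_le_mul_of_nonneg_left hfin hlampos.le
    _ = _ := by field_simp
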